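/- Let R be an integral domain and Ê a w-universal injective R-module. A w-monomorphism f : N → M of R-modules is w-pure if and only if the natural homomorphism Hom_R(M, Ê) → Hom_R(N, Ê), φ ↦ φ ∘ f (which is surjective), admits a section, i.e., there exists an R-linear map s : Hom_R(N, Ê) → Hom_R(M, Ê) with (− ∘ f) ∘ s = id. -/

import Mathlib

open TensorProduct

/-- A finitely generated ideal `J` is a GV-ideal if the natural map
`R → Hom_R(J, R)`, sending `r` to multiplication by `r`, is bijective. -/
def IsGVIdeal {R : Type*} [CommRing R] (J : Ideal R) : Prop :=
  J.FG ∧ Function.Bijective fun r : R => (r • J.subtype : J →ₗ[R] R)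

/-- An element `m` of an `R`-module is a GV-torsion element if it is
annihilated by some GV-ideal. -/
def IsGVTorsionElem (R : Type*) [CommRing R] {M : Type*} [AddCommGroup M] [Module R M]
    (m : M) : Prop :=
  ∃ J : Ideal R, IsGVIdeal J ∧ ∀ j ∈ J, j • m = 0

/-- An `R`-module `E` is `w`-universal injective if `E` is injective, GV-torsion-free,
and for every GV-torsion-free module `A` and nonzero `x ∈ A` there is `f : A → E`
with `f x ≠ 0`. -/
def IsWUniversalInjective (R : Type u) [CommRing R] (E : Type u) [AddCommGroup E]
    [Module R E] : Prop :=
  Module.Injective R E ∧ (∀ e : E, IsGVTorsionElem R e → e = 0) ∧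
  ∀ (A : Type u) [AddCommGroup A] [Module R A],
    (∀ a : A, IsGVTorsionElem R a → a = 0) →
    ∀ x : A, x ≠ 0 → ∃ f : A →ₗ[R] E, f x ≠ 0

/-- The product of two GV-ideals is a GV-ideal. -/
theorem IsGVIdeal.mul {R : Type*} [CommRing R] {I J : Ideal R} (hI : IsGVIdeal I)
    (hJ : IsGVIdeal J) : IsGVIdeal (I * J) := by
  have zero_of_mul {K : Ideal R} (hK : IsGVIdeal K) (r : R) (h : ∀ k ∈ K, r * k = 0) :
      r = 0 := hK.2.1 (LinearMap.ext fun k => by simpa using h k k.2)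
  refine ⟨Submodule.FG.mul hI.1 hJ.1, fun r r' hrr' => ?_, fun φ => ?_⟩
  · refine sub_eq_zero.1 (zero_of_mul hI _ fun a ha => zero_of_mul hJ _ fun b hb => ?_)
    have := LinearMap.congr_fun hrr' ⟨a * b, Ideal.mul_mem_mul ha hb⟩
    simp only [LinearMap.smul_apply, Submodule.subtype_apply, smul_eq_mul] at this
    linear_combination this
  · let e : R ≃ₗ[R] (J →ₗ[R] R) := LinearEquiv.ofBijective
      (LinearMap.toSpanSingleton R (J →ₗ[R] R) J.subtype) hJ.2
    let ψ : I →ₗ[R] J →ₗ[R] R := LinearMap.mk₂ R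
      (fun a b => φ ⟨a * b, Ideal.mul_mem_mul a.2 b.2⟩)
      (fun a a' b => by rw [← map_add]; congr 1; ext; simp [add_mul])
      (fun c a b => by rw [← map_smul]; congr 1; ext; simp [mul_assoc])
      (fun a b b' => by rw [← map_add]; congr 1; ext; simp [mul_add])
      (fun c a b => by rw [← map_smul]; congr 1; ext; simp [mul_left_comm])
    obtain ⟨r, hr⟩ := hI.2.2 (e.symm.toLinearMap ∘ₗ ψ)
    have hφ (a : R) (ha : a ∈ I) (b : R) (hb : b ∈ J) :
        φ ⟨a * b, Ideal.mul_mem_mul ha hb⟩ = r * (a * b) := by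
      have h₁ : r * a = e.symm (ψ ⟨a, ha⟩) := LinearMap.congr_fun hr ⟨a, ha⟩
      have h₂ : (r * a) * b = ψ ⟨a, ha⟩ ⟨b, hb⟩ :=
        LinearMap.congr_fun (e.eq_symm_apply.1 h₁) ⟨b, hb⟩
      rw [← mul_assoc, h₂]
      rfl
    refine ⟨r, LinearMap.ext ?_⟩
    rintro ⟨x, hx⟩
    change r * x = φ ⟨x, hx⟩
    induction hx using Submodule.mul_induction_on' with
    | mem_mul_mem a ha b hb => exact (hφ a ha b hb).symm
    | add x hx y hy ihx ihy => rw [mul_add, ihx, ihy, ← map_add]; rfl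

theorem isGVIdeal_top {R : Type*} [CommRing R] : IsGVIdeal (⊤ : Ideal R) := by
  refine ⟨⟨{1}, by simp⟩, fun r r' h => ?_, fun φ => ⟨φ ⟨1, trivial⟩, LinearMap.ext fun x => ?_⟩⟩
  · simpa using LinearMap.congr_fun h ⟨1, trivial⟩
  · have : x = (x : R) • (⟨1, trivial⟩ : (⊤ : Ideal R)) := by ext; simp
    conv_rhs => rw [this, map_smul]
    simp [mul_comm]

theorem IsGVTorsionElem.map {R : Type*} [CommRing R] {A B : Type*} [AddCommGroup A] [Module R A]
    [AddCommGroup B] [Module R B] {a : A} (ha : IsGVTorsionElem R a) (g : A →ₗ[R] B) :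
    IsGVTorsionElem R (g a) := by
  obtain ⟨J, hJ, h⟩ := ha
  exact ⟨J, hJ, fun j hj => by rw [← map_smul, h j hj, map_zero]⟩

/-- The submodule of GV-torsion elements. -/
def gvTorsion (R A : Type*) [CommRing R] [AddCommGroup A] [Module R A] : Submodule R A where
  carrier := {a | IsGVTorsionElem R a}
  zero_mem' := ⟨⊤, isGVIdeal_top, fun _ _ => smul_zero _⟩
  add_mem' := by
    rintro a b ⟨I, hI, ha⟩ ⟨J, hJ, hb⟩
    refine ⟨I * J, hI.mul hJ, fun r hr => ?_⟩
    rw [smul_add, ha r (Ideal.mul_le_left hr), hb r (Ideal.mul_le_right hr), add_zero]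
  smul_mem' c _ ha := ha.map (LinearMap.lsmul R A c)

/-- A finitely generated GV-torsion submodule is annihilated by a single GV-ideal. -/
theorem exists_isGVIdeal_le_annihilator {R A : Type*} [CommRing R] [AddCommGroup A] [Module R A]
    {P : Submodule R A} (hP : P.FG) (h : P ≤ gvTorsion R A) :
    ∃ J : Ideal R, IsGVIdeal J ∧ J ≤ P.annihilator := by
  induction P, hP using Submodule.fg_induction with
  | singleton a =>
    obtain ⟨J, hJ, ha⟩ := h (Submodule.mem_span_singleton_self a)
    exact ⟨J, hJ, fun j hj => (Submodule.mem_annihilator_span_singleton a j).2 (ha j hj)⟩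
  | sup P Q _ _ ihP ihQ =>
    obtain ⟨I, hI, hIP⟩ := ihP (le_sup_left.trans h)
    obtain ⟨J, hJ, hJQ⟩ := ihQ (le_sup_right.trans h)
    refine ⟨I * J, hI.mul hJ, ?_⟩
    rw [Submodule.annihilator_sup]
    exact le_inf (Ideal.mul_le_left.trans hIP) (Ideal.mul_le_right.trans hJQ)

theorem isGVTorsionElem_of_forall_smul {R A : Type*} [CommRing R] [AddCommGroup A] [Module R A]
    {J : Ideal R} (hJ : IsGVIdeal J) {a : A} (h : ∀ j ∈ J, IsGVTorsionElem R (j • a)) :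
    IsGVTorsionElem R a := by
  obtain ⟨I, hI, hIa⟩ := exists_isGVIdeal_le_annihilator
    (P := Submodule.map (LinearMap.toSpanSingleton R A a) J) (Submodule.FG.map _ hJ.1)
    (by rintro _ ⟨j, hj, rfl⟩; exact h j hj)
  refine ⟨I * J, hI.mul hJ, fun r hr => ?_⟩
  induction hr using Submodule.mul_induction_on' with
  | mem_mul_mem i hi j hj =>
    rw [mul_smul]
    exact Submodule.mem_annihilator.1 (hIa hi) _ ⟨j, hj, rfl⟩
  | add x _ y _ hx hy => rw [add_smul, hx, hy, add_zero]

theorem eq_zero_of_isGVTorsionElem_quotient {R A : Type*} [CommRing R] [AddCommGroup A]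
    [Module R A] (q : A ⧸ gvTorsion R A) (hq : IsGVTorsionElem R q) : q = 0 := by
  obtain ⟨a, rfl⟩ := Submodule.mkQ_surjective _ q
  obtain ⟨J, hJ, h⟩ := hq
  refine (Submodule.Quotient.mk_eq_zero _).2
    (isGVTorsionElem_of_forall_smul hJ fun j hj => (Submodule.Quotient.mk_eq_zero _).1 (h j hj))

/-- An element killed by every map to a `w`-universal injective module is GV-torsion. -/
theorem IsWUniversalInjective.isGVTorsionElem {R : Type u} [CommRing R] {E : Type u}
    [AddCommGroup E] [Module R E] (hE : IsWUniversalInjective R E) {A : Type u} [AddCommGroup A]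
    [Module R A] {a : A} (h : ∀ g : A →ₗ[R] E, g a = 0) : IsGVTorsionElem R a := by
  by_contra ha
  obtain ⟨g, hg⟩ := hE.2.2 (A ⧸ gvTorsion R A) eq_zero_of_isGVTorsionElem_quotient
    (Submodule.Quotient.mk a) fun h0 => ha ((Submodule.Quotient.mk_eq_zero _).1 h0)
  exact hg (h (g ∘ₗ (gvTorsion R A).mkQ))

/-- A map to a `w`-universal injective module extends along any `w`-monomorphism. -/
theorem IsWUniversalInjective.exists_extension {R : Type u} [CommRing R] {E : Type u}
    [AddCommGroup E] [Module R E] (hE : IsWUniversalInjective R E) {A B : Type u}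
    [AddCommGroup A] [Module R A] [AddCommGroup B] [Module R B] (i : A →ₗ[R] B)
    (hi : ∀ x ∈ LinearMap.ker i, IsGVTorsionElem R x) (g : A →ₗ[R] E) :
    ∃ h : B →ₗ[R] E, h ∘ₗ i = g := by
  have hker : LinearMap.ker i ≤ LinearMap.ker g := fun x hx => hE.2.1 _ ((hi x hx).map g)
  obtain ⟨h, hh⟩ := hE.1.out ((LinearMap.ker i).liftQ i le_rfl)
    (LinearMap.ker_eq_bot.1 (Submodule.ker_liftQ_eq_bot' _ _ rfl)) ((LinearMap.ker i).liftQ g hker)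
  exact ⟨h, LinearMap.ext fun x => hh (Submodule.Quotient.mk x)⟩

/-- for a `w`-universal injective module `Ehat`, a `w`-monomorphism
`f : N → M` is `w`-pure iff the natural map `Hom_R(M, Ehat) → Hom_R(N, Ehat)` admits a
section. -/
theorem wpure_iff_hom_section
    {R : Type u} [CommRing R] [IsDomain R]
    (Ehat : Type u) [AddCommGroup Ehat] [Module R Ehat]
    (hE : IsWUniversalInjective R Ehat)
    {N M : Type u} [AddCommGroup N] [Module R N] [AddCommGroup M] [Module R M]
    (f : N →ₗ[R] M)
    (hmono : ∀ x ∈ LinearMap.ker f, IsGVTorsionElem R x) :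
    (∀ (L : Type u) [AddCommGroup L] [Module R L],
      ∀ x ∈ LinearMap.ker (LinearMap.lTensor L f), IsGVTorsionElem R x) ↔
    ∃ s : (N →ₗ[R] Ehat) →ₗ[R] (M →ₗ[R] Ehat),
      (LinearMap.lcomp R Ehat f) ∘ₗ s = LinearMap.id := by
  constructor
  · intro hpure
    obtain ⟨h, hh⟩ := hE.exists_extension _ (hpure (N →ₗ[R] Ehat))
      (TensorProduct.lift LinearMap.id)
    exact ⟨TensorProduct.curry h, LinearMap.ext fun φ => LinearMap.ext fun n =>
      LinearMap.congr_fun hh (φ ⊗ₜ[R] n)⟩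
  · rintro ⟨s, hs⟩ L _ _ x hx
    refine hE.isGVTorsionElem fun g => ?_
    have hg : g = TensorProduct.lift (s ∘ₗ TensorProduct.curry g) ∘ₗ LinearMap.lTensor L f :=
      TensorProduct.ext' fun l n =>
        (LinearMap.congr_fun (LinearMap.congr_fun hs (TensorProduct.curry g l)) n).symm
    rw [hg, LinearMap.comp_apply, LinearMap.mem_ker.1 hx, map_zero]
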